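/- Let p > 0, let N ∈ ℕ, and define a_N : G_m → ℂ by a_N = M_N^{1/p − 1} (D_{M_{N+1}} − D_{M_N}). Then for every n ∈ ℕ with M_N < n ≤ M_{N+1}, one has the pointwise identity σ_n a_N(x) = (M_N^{1/p − 1} (n − M_N) / n) · ψ_{M_N}(x) · K_{n − M_N}(x) for all x ∈ G_m. -/

import Mathlib

open MeasureTheory Finset

noncomputable section

namespace Vilenkin

instance (n : ℕ) : MeasurableSpace (ZMod n) := ⊤

abbrev G (m : ℕ → ℕ) : Type := ∀ k, ZMod (m k)

def M (m : ℕ → ℕ) : ℕ → ℕ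
  | 0 => 1
  | k + 1 => m k * M m k

def digit (m : ℕ → ℕ) (n k : ℕ) : ℕ := (n / M m k) % m k

def rad (m : ℕ → ℕ) (k : ℕ) (x : G m) : ℂ :=
  Complex.exp (2 * (Real.pi : ℂ) * Complex.I * ((x k).val : ℂ) / (m k : ℂ))

def psi (m : ℕ → ℕ) (n : ℕ) (x : G m) : ℂ :=
  ∏ k ∈ Finset.range (n + 1), rad m k x ^ digit m n k

def D (m : ℕ → ℕ) (n : ℕ) (x : G m) : ℂ := ∑ k ∈ Finset.range n, psi m k x

def K (m : ℕ → ℕ) (n : ℕ) (x : G m) : ℂ := (n : ℂ)⁻¹ * ∑ k ∈ Finset.range n, D m k x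

def cyl (m : ℕ → ℕ) (n : ℕ) (x : G m) : Set (G m) := {y | ∀ j < n, y j = x j}

def e (m : ℕ → ℕ) (k : ℕ) : G m := fun j => if j = k then 1 else 0

def lo (m : ℕ → ℕ) (n : ℕ) : ℕ := sInf {j | digit m n j ≠ 0}

def hi (m : ℕ → ℕ) (n : ℕ) : ℕ := sSup {j | digit m n j ≠ 0}

def Iij (m : ℕ → ℕ) (N i j : ℕ) : Set (G m) :=
  if j = N then {x | x i ≠ 0 ∧ ∀ t < N, t ≠ i → x t = 0}
  else {x | (∀ t < i, x t = 0) ∧ x i ≠ 0 ∧ (∀ t, i < t → t < j → x t = 0) ∧ x j ≠ 0}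

def IsVilenkinMeasure (m : ℕ → ℕ) (μ : Measure (G m)) : Prop :=
  IsProbabilityMeasure μ ∧ ∀ (n : ℕ) (x : G m), μ (cyl m n x) = (M m n : ENNReal)⁻¹

def fhat (m : ℕ → ℕ) (μ : Measure (G m)) (f : G m → ℂ) (k : ℕ) : ℂ :=
  ∫ x, f x * (starRingEnd ℂ) (psi m k x) ∂μ

def S (m : ℕ → ℕ) (μ : Measure (G m)) (f : G m → ℂ) (n : ℕ) (x : G m) : ℂ :=
  ∑ k ∈ Finset.range n, fhat m μ f k * psi m k x

def sigma (m : ℕ → ℕ) (μ : Measure (G m)) (f : G m → ℂ) (n : ℕ) (x : G m) : ℂ :=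
  (n : ℂ)⁻¹ * ∑ k ∈ Finset.range n, S m μ f k x

end Vilenkin

open Vilenkin

namespace Vilenkin

lemma M_pos (m : ℕ → ℕ) (hm : ∀ k, 2 ≤ m k) (k : ℕ) : 0 < M m k := by
  induction k with
  | zero => simp [M]
  | succ k ih =>
    have := hm k
    simp only [M]; positivity

lemma lt_M (m : ℕ → ℕ) (hm : ∀ k, 2 ≤ m k) (k : ℕ) : k < M m k := by
  induction k with
  | zero => simp [M]
  | succ k ih =>
    have := hm k
    simp only [M]; nlinarith

lemma M_dvd (m : ℕ → ℕ) {k l : ℕ} (h : k ≤ l) : M m k ∣ M m l := by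
  induction l, h using Nat.le_induction with
  | base => exact dvd_rfl
  | succ l _ ih => exact ih.trans (by simp [M])

lemma digit_zero (m : ℕ → ℕ) (hm : ∀ k, 2 ≤ m k) {n k l : ℕ} (h : n < M m k) (hk : k ≤ l) :
    digit m n l = 0 := by
  have := Nat.le_of_dvd (M_pos m hm l) (M_dvd m hk)
  simp [digit, Nat.div_eq_of_lt (h.trans_le this)]

lemma psi_eq (m : ℕ → ℕ) (hm : ∀ k, 2 ≤ m k) {n L : ℕ} (h : n < M m L) (x : G m) :
    psi m n x = ∏ k ∈ range L, rad m k x ^ digit m n k := by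
  have key : ∀ A B, A ≤ B → n < M m A →
      ∏ k ∈ range A, rad m k x ^ digit m n k = ∏ k ∈ range B, rad m k x ^ digit m n k := by
    intro A B hAB hA
    apply prod_subset (range_mono hAB)
    intro k _ hk
    rw [digit_zero m hm hA (by simpa using hk), pow_zero]
  have h1 : n < M m (n+1) := (Nat.lt_succ_self n).trans (lt_M m hm _)
  unfold psi
  rcases le_total (n+1) L with h' | h'
  · exact key _ _ h' h1
  · exact (key _ _ h' h).symm

lemma psi_add (m : ℕ → ℕ) (hm : ∀ k, 2 ≤ m k) {N j : ℕ} (h : M m N + j < M m (N+1)) (x : G m) :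
    psi m (M m N + j) x = rad m N x * psi m j x := by
  rw [psi_eq m hm h, psi_eq m hm (lt_of_le_of_lt (Nat.le_add_left j _) h), prod_range_succ,
    prod_range_succ]
  have hN : digit m (M m N + j) N = digit m j N + 1 := by
    have hp := M_pos m hm N
    have h2 : (M m N + j) / M m N = j / M m N + 1 := by
      rw [add_comm, Nat.add_div_right _ hp]
    have h3 : (M m N + j) / M m N < m N := by
      rw [Nat.div_lt_iff_lt_mul hp]; exact h
    unfold digit
    rw [Nat.mod_eq_of_lt h3, h2, Nat.mod_eq_of_lt (by omega)]
  have hk : ∀ k ∈ range N, rad m k x ^ digit m (M m N + j) k = rad m k x ^ digit m j k := by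
    intro k hk
    obtain ⟨c, hc⟩ := M_dvd m (show k + 1 ≤ N by simpa using hk)
    have : M m N = M m k * (m k * c) := by rw [hc]; simp only [M]; ring
    unfold digit
    rw [this, Nat.mul_add_div (M_pos m hm k), Nat.mul_add_mod]
  rw [prod_congr rfl hk, hN]
  ring

lemma digit_inj (m : ℕ → ℕ) {i j L : ℕ} (h : ∀ k < L, digit m i k = digit m j k) :
    i % M m L = j % M m L := by
  induction L with
  | zero => simp [M, Nat.mod_one]
  | succ L ih =>
    have h1 := ih fun k hk => h k (by omega)
    have h2 := h L (by omega)
    unfold digit at h2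
    simp only [M]
    rw [mul_comm, Nat.mod_mul, Nat.mod_mul, h1, h2]

lemma sum_char (q : ℕ) (hq : 2 ≤ q) (s t : ℕ) (hs : s < q) (ht : t < q) [Fintype (ZMod q)] :
    ∑ a : ZMod q, (Complex.exp (2 * (Real.pi : ℂ) * Complex.I * (a.val : ℂ) / (q : ℂ))) ^ s *
      (starRingEnd ℂ) ((Complex.exp (2 * (Real.pi : ℂ) * Complex.I * (a.val : ℂ) / (q : ℂ))) ^ t)
      = if s = t then (q : ℂ) else 0 := by
  obtain ⟨r, rfl⟩ : ∃ r, q = r + 1 := ⟨q - 1, by omega⟩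
  set ζ := Complex.exp (2 * (Real.pi : ℂ) * Complex.I / ((r + 1 : ℕ) : ℂ)) with hζ
  have hprim : IsPrimitiveRoot ζ (r+1) := Complex.isPrimitiveRoot_exp (r+1) (by omega)
  have hζ0 : ζ ≠ 0 := Complex.exp_ne_zero _
  have hconj : (starRingEnd ℂ) ζ = ζ⁻¹ :=
    (Complex.inv_eq_conj (hprim.norm'_eq_one (by omega))).symm
  have hterm : ∀ a : ZMod (r+1),
      (Complex.exp (2 * (Real.pi : ℂ) * Complex.I * (a.val : ℂ) / ((r+1 : ℕ) : ℂ))) = ζ ^ a.val := by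
    intro a
    rw [hζ, ← Complex.exp_nat_mul]
    congr 1; ring
  set z := ζ ^ s * (ζ⁻¹) ^ t with hz
  have h1 : ∀ a : ZMod (r+1), (ζ ^ a.val) ^ s * (starRingEnd ℂ) ((ζ ^ a.val) ^ t) = z ^ a.val := by
    intro a
    rw [map_pow, map_pow, hconj, hz, mul_pow]
    simp only [← pow_mul, mul_comm]
  simp only [hterm, h1]
  have h2 : ∑ a : ZMod (r+1), z ^ a.val = ∑ i ∈ range (r+1), z ^ i := by
    rw [← Fin.sum_univ_eq_sum_range (fun i => z ^ i)]
    exact Fintype.sum_equiv (ι := ZMod (r+1)) (κ := Fin (r+1)) (M := ℂ) (Equiv.refl (Fin (r+1)))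
      (fun a => z ^ a.val) (fun a => z ^ (a : ℕ)) fun a => rfl
  rw [h2]
  split_ifs with hst
  · subst hst
    have : z = 1 := by rw [hz, ← mul_pow, mul_inv_cancel₀ hζ0, one_pow]
    simp [this]
  · have hz1 : z ≠ 1 := by
      intro h
      apply hst
      apply hprim.pow_inj hs ht
      rw [hz, inv_pow] at h
      exact (mul_inv_eq_one₀ (pow_ne_zero _ hζ0)).1 h
    rw [geom_sum_eq hz1]
    have : z ^ (r+1) = 1 := by
      rw [hz, mul_pow, ← pow_mul, ← pow_mul, mul_comm s, mul_comm t, pow_mul, pow_mul, inv_pow,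
        hprim.pow_eq_one]; simp
    simp [this]

def pr (m : ℕ → ℕ) (L : ℕ) (x : G m) : ∀ k : Fin L, ZMod (m k) := fun k => x k

lemma measurable_pr (m : ℕ → ℕ) (L : ℕ) : Measurable (pr m L) :=
  measurable_pi_lambda _ fun k => measurable_pi_apply (k : ℕ)

lemma prod_M (m : ℕ → ℕ) (L : ℕ) : ∏ k ∈ range L, m k = M m L := by
  induction L with
  | zero => simp [M]
  | succ L ih => rw [prod_range_succ, ih, M, mul_comm]

lemma integral_pr (m : ℕ → ℕ) (hm : ∀ k, 2 ≤ m k) (μ : Measure (G m)) (hμ : IsVilenkinMeasure m μ)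
    (L : ℕ) [∀ k : Fin L, Fintype (ZMod (m k))] (F : (∀ k : Fin L, ZMod (m k)) → ℂ) :
    Integrable (fun x => F (pr m L x)) μ ∧
    ∫ x, F (pr m L x) ∂μ = (M m L : ℂ)⁻¹ * ∑ u, F u := by
  haveI := hμ.1
  haveI : ∀ n, DiscreteMeasurableSpace (ZMod n) := fun n => ⟨fun _ => trivial⟩
  haveI : IsProbabilityMeasure (μ.map (pr m L)) :=
    Measure.isProbabilityMeasure_map (measurable_pr m L).aemeasurable
  have hF : Integrable F (μ.map (pr m L)) := Integrable.of_finite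
  refine ⟨hF.comp_measurable (measurable_pr m L), ?_⟩
  rw [← integral_map (measurable_pr m L).aemeasurable hF.1, integral_fintype hF, mul_sum]
  refine sum_congr rfl fun u _ => ?_
  have : (μ.map (pr m L)).real {u} = (M m L : ℝ)⁻¹ := by
    rw [Measure.real, Measure.map_apply (measurable_pr m L) (measurableSet_singleton u)]
    have : pr m L ⁻¹' {u} = cyl m L (fun k => if h : k < L then u ⟨k, h⟩ else 0) := by
      ext y
      simp only [Set.mem_preimage, Set.mem_singleton_iff, cyl, Set.mem_setOf_eq, pr, funext_iff]
      constructor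
      · intro h j hj
        simp [hj, ← h ⟨j, hj⟩]
      · intro h j
        simp [h j j.2]
    rw [this, hμ.2]; simp
  rw [this]; simp

lemma ortho (m : ℕ → ℕ) (hm : ∀ k, 2 ≤ m k) (μ : Measure (G m)) (hμ : IsVilenkinMeasure m μ)
    (L i j : ℕ) (hi : i < M m L) (hj : j < M m L) :
    Integrable (fun x => psi m i x * (starRingEnd ℂ) (psi m j x)) μ ∧
    ∫ x, psi m i x * (starRingEnd ℂ) (psi m j x) ∂μ = if i = j then 1 else 0 := by
  haveI : ∀ k, NeZero (m k) := fun k => ⟨by have := hm k; omega⟩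
  let c : ∀ k, ZMod (m k) → ℂ := fun k a =>
    (Complex.exp (2 * (Real.pi : ℂ) * Complex.I * (a.val : ℂ) / (m k : ℂ))) ^ digit m i k *
      (starRingEnd ℂ) ((Complex.exp (2 * (Real.pi : ℂ) * Complex.I * (a.val : ℂ) / (m k : ℂ)))
        ^ digit m j k)
  have hfun : (fun x => psi m i x * (starRingEnd ℂ) (psi m j x)) =
      fun x => (fun u : (∀ k : Fin L, ZMod (m k)) => ∏ k : Fin L, c k (u k)) (pr m L x) := by
    funext x
    rw [psi_eq m hm hi, psi_eq m hm hj, map_prod, ← prod_mul_distrib,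
      ← Fin.prod_univ_eq_prod_range (fun k => rad m k x ^ digit m i k *
        (starRingEnd ℂ) (rad m k x ^ digit m j k))]
    rfl
  rw [hfun]
  obtain ⟨h1, h2⟩ := integral_pr m hm μ hμ L (fun u => ∏ k : Fin L, c k (u k))
  refine ⟨h1, h2.trans ?_⟩
  have h3 : ∑ u : (∀ k : Fin L, ZMod (m k)), ∏ k : Fin L, c k (u k) =
      ∏ k : Fin L, ∑ a : ZMod (m k), c k a :=
    (Fintype.prod_sum fun (k : Fin L) (a : ZMod (m k)) => c k a).symm
  have hd : ∀ n k, digit m n k < m k := fun n k => Nat.mod_lt _ (by have := hm k; omega)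
  rw [h3]
  have h4 : ∀ k : Fin L, ∑ a : ZMod (m k), c k a =
      if digit m i k = digit m j k then (m k : ℂ) else 0 :=
    fun k => sum_char (m k) (hm k) _ _ (hd _ _) (hd _ _)
  simp only [h4]
  have hM : (M m L : ℂ) ≠ 0 := by exact_mod_cast (M_pos m hm L).ne'
  split_ifs with hij
  · subst hij
    simp only [if_true]
    rw [Fin.prod_univ_eq_prod_range (fun k => (m k : ℂ)), ← Nat.cast_prod, prod_M,
      inv_mul_cancel₀ hM]
  · have : ∃ k < L, digit m i k ≠ digit m j k := by
      by_contra! hcon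
      have := digit_inj m hcon
      rw [Nat.mod_eq_of_lt hi, Nat.mod_eq_of_lt hj] at this
      exact hij this
    obtain ⟨k, hk, hne⟩ := this
    rw [prod_eq_zero (mem_univ (⟨k, hk⟩ : Fin L)) (by simp [hne]), mul_zero]

lemma fhat_a (m : ℕ → ℕ) (hm : ∀ k, 2 ≤ m k) (μ : Measure (G m)) (hμ : IsVilenkinMeasure m μ)
    (C : ℂ) (N k : ℕ) (hk : k < M m (N+1)) :
    fhat m μ (fun y => C * (D m (M m (N + 1)) y - D m (M m N) y)) k =
      if M m N ≤ k then C else 0 := by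
  have hle : M m N ≤ M m (N+1) := Nat.le_of_dvd (M_pos m hm _) (M_dvd m (Nat.le_succ N))
  have hfun : (fun x => C * (D m (M m (N + 1)) x - D m (M m N) x) * (starRingEnd ℂ) (psi m k x)) =
      fun x => C * ∑ i ∈ Ico (M m N) (M m (N+1)), psi m i x * (starRingEnd ℂ) (psi m k x) := by
    funext x
    rw [D, D, ← sum_Ico_eq_sub _ hle, mul_assoc, sum_mul]
  unfold fhat
  rw [hfun, integral_const_mul, integral_finsetSum _ fun i hi =>
    (ortho m hm μ hμ (N+1) i k (mem_Ico.1 hi).2 hk).1]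
  rw [sum_congr rfl fun i hi => (ortho m hm μ hμ (N+1) i k (mem_Ico.1 hi).2 hk).2]
  simp [hk]

lemma S_a (m : ℕ → ℕ) (hm : ∀ k, 2 ≤ m k) (μ : Measure (G m)) (hμ : IsVilenkinMeasure m μ)
    (C : ℂ) (N k : ℕ) (hk : k ≤ M m (N+1)) (x : G m) :
    S m μ (fun y => C * (D m (M m (N + 1)) y - D m (M m N) y)) k x =
      C * (psi m (M m N) x * D m (k - M m N) x) := by
  have hlt : M m N < M m (N+1) := by
    have := hm N
    have := M_pos m hm N
    simp only [M]; nlinarith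
  have hr : psi m (M m N) x = rad m N x := by
    have := psi_add m hm (N := N) (j := 0) (by simpa using hlt) x
    simpa [psi, digit] using this
  have h0 : ∀ i ∈ range k, fhat m μ (fun y => C * (D m (M m (N + 1)) y - D m (M m N) y)) i
      * psi m i x = if M m N ≤ i then C * psi m i x else 0 := by
    intro i hi
    rw [fhat_a m hm μ hμ C N i ((mem_range.1 hi).trans_le hk), ite_mul, zero_mul]
  unfold S
  rw [sum_congr rfl h0, ← sum_filter]
  have : (range k).filter (fun i => M m N ≤ i) = Ico (M m N) k := by
    ext i; simp [and_comm]
  rw [this, sum_Ico_eq_sum_range, D, mul_sum, mul_sum]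
  refine sum_congr rfl fun j hj => ?_
  rw [psi_add m hm (by have := mem_range.1 hj; omega), hr]

end Vilenkin

theorem statement18 (m : ℕ → ℕ) (hm : ∀ k, 2 ≤ m k)
    (μ : Measure (G m)) (hμ : IsVilenkinMeasure m μ)
    (p : ℝ) (hp : 0 < p) (N n : ℕ) (hn1 : M m N < n) (hn2 : n ≤ M m (N + 1)) (x : G m) :
    sigma m μ
        (fun y => ((((M m N : ℝ) ^ (1 / p - 1) : ℝ)) : ℂ) *
          (D m (M m (N + 1)) y - D m (M m N) y)) n x =
      ((((M m N : ℝ) ^ (1 / p - 1) : ℝ)) : ℂ) * (((n - M m N : ℕ) : ℂ) / (n : ℂ)) *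
        psi m (M m N) x * K m (n - M m N) x := by
  unfold sigma K
  rw [sum_congr rfl fun k hk => S_a m hm μ hμ _ N k ((mem_range.1 hk).le.trans hn2) x]
  rw [← mul_sum, ← mul_sum]
  have hs : ∑ k ∈ range n, D m (k - M m N) x = ∑ k ∈ range (n - M m N), D m k x := by
    rw [← sum_range_add_sum_Ico _ hn1.le, sum_Ico_eq_sum_range, sum_eq_zero, zero_add]
    · simp
    · intro i hi
      rw [Nat.sub_eq_zero_of_le (mem_range.1 hi).le]; simp [D]
  rw [hs]
  have h1 : ((n - M m N : ℕ) : ℂ) ≠ 0 := by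
    have : n - M m N ≠ 0 := by omega
    exact_mod_cast this
  have h2 : (n : ℂ) ≠ 0 := by
    have : n ≠ 0 := by omega
    exact_mod_cast this
  field_simp
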